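/- arXiv:math/9910087 — 3 statements merged into one kernel-verified Lean document; each statement's English description precedes it below -/
import Mathlib

section
/- For any positive integers x and y and any integer m, the number of multisets of x integers drawn from {0, 1, …, y−1} whose sum is congruent to m modulo y equals the number of multisets of y integers drawn from {0, 1, …, x−1} whose sum is congruent to m modulo x. -/
/-- sum of a multiset over `Fin k`. -/
def symVal {k x : ℕ} (S : Sym (Fin k) x) : ℕ := ((S : Multiset (Fin k)).map (fun a : Fin k => a.val)).sum

theorem sum_sym_succ (f : ℕ → ℕ) (k x : ℕ) :
    ∑ S : Sym (Fin (k+1)) (x+1), f (symVal S)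
      = ∑ S : Sym (Fin (k+1)) x, f (symVal S)
        + ∑ S : Sym (Fin k) (x+1), f (symVal S + (x + 1)) := by
  classical
  rw [← Fintype.sum_subtype_add_sum_subtype (fun S : Sym (Fin (k+1)) (x+1) => (0 : Fin (k+1)) ∈ S)]
  congr 1
  · refine (Fintype.sum_equiv Sym.e1.symm _ _ ?_).symm
    intro S
    simp [Sym.e1, symVal, Sym.coe_cons]
  · cases k with
    | zero =>
      have h1 : IsEmpty (Sym (Fin 0) (x+1)) := inferInstance
      have h2 : IsEmpty {S : Sym (Fin (0+1)) (x+1) // ¬ (0 : Fin (0+1)) ∈ S} := by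
        refine ⟨fun ⟨S, hS⟩ => hS ?_⟩
        obtain ⟨a, ha⟩ := Sym.exists_mem S
        have : a = 0 := Fin.fin_one_eq_zero a
        exact this ▸ ha
      rw [Fintype.sum_empty, Fintype.sum_empty]
    | succ k =>
      refine (Fintype.sum_equiv Sym.e2.symm _ _ ?_).symm
      intro S
      have hc : Multiset.card (S : Multiset (Fin (k+1))) = x + 1 := S.2
      congr 1
      simp [Sym.e2, symVal, Multiset.map_map, Function.comp_def, Multiset.sum_map_add, hc]
      omega

theorem stars_bars (x : ℕ) : ∀ (y a : ℕ) (f : ℕ → ℕ),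
    ∑ A ∈ Finset.powersetCard x (Finset.Ico a (a + x + y)), f (∑ i ∈ A, i)
      = ∑ S : Sym (Fin (y+1)) x, f (symVal S + a * x + x.choose 2) := by
  induction x with
  | zero =>
    intro y a f
    rw [Fintype.sum_unique]
    simp [symVal]
    rfl
  | succ x ihx =>
    have key : ∀ (y a : ℕ) (f : ℕ → ℕ),
        ∑ A ∈ Finset.powersetCard (x+1) (Finset.Ico a (a + (x+1) + y)), f (∑ i ∈ A, i)
        = ∑ A ∈ Finset.powersetCard (x+1) (Finset.Ico (a+1) (a + (x+1) + y)), f (∑ i ∈ A, i)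
        + ∑ A ∈ Finset.powersetCard x (Finset.Ico (a+1) (a+1+x+y)), f (a + ∑ i ∈ A, i) := by
      intro y a f
      have h0 : a ∉ Finset.Ico (a+1) (a + (x+1) + y) := by simp
      have h0' : ∀ A ∈ Finset.powersetCard x (Finset.Ico (a+1) (a + (x+1) + y)), a ∉ A :=
        fun A hA h => h0 ((Finset.mem_powersetCard.1 hA).1 h)
      have e : Finset.Ico a (a + (x+1) + y) = insert a (Finset.Ico (a+1) (a + (x+1) + y)) := by
        ext i; simp; omega
      rw [e, Finset.powersetCard_succ_insert h0, Finset.sum_union, Finset.sum_image]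
      · congr 1
        have : a + (x+1) + y = a + 1 + x + y := by ring
        rw [← this]
        refine Finset.sum_congr rfl fun A hA => ?_
        rw [Finset.sum_insert (h0' A hA)]
      · intro A hA B hB h
        have := congrArg (fun s => s.erase a) h
        simpa [Finset.erase_insert (h0' A hA), Finset.erase_insert (h0' B hB)] using this
      · rw [Finset.disjoint_left]
        intro A hA hA'
        obtain ⟨B, hB, rfl⟩ := Finset.mem_image.1 hA'
        exact h0 ((Finset.mem_powersetCard.1 hA).1 (Finset.mem_insert_self _ _))
    have hch : (x+1).choose 2 = x + x.choose 2 := by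
      rw [Nat.choose_succ_succ' x 1]; simp
    intro y
    induction y with
    | zero =>
      intro a f
      rw [key, ihx 0 (a+1) (fun t => f (a + t)),
        sum_sym_succ (fun t => f (t + a * (x+1) + (x+1).choose 2)) 0 x,
        Finset.powersetCard_eq_empty.2 (by simp; omega)]
      have h1 : IsEmpty (Sym (Fin 0) (x+1)) := inferInstance
      rw [Fintype.sum_empty (ι := Sym (Fin 0) (x+1)), Finset.sum_empty, hch, zero_add, add_zero]
      refine Finset.sum_congr rfl fun S _ => ?_
      congr 1; ring
    | succ y ihy =>
      intro a f
      have e : a + (x+1) + (y+1) = (a + 1) + (x + 1) + y := by ring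
      rw [key, ihx (y+1) (a+1) (fun t => f (a + t)), e, ihy (a+1) f,
        sum_sym_succ (fun t => f (t + a * (x+1) + (x+1).choose 2)) (y+1) x, hch, add_comm]
      congr 1
      · refine Finset.sum_congr rfl fun S _ => ?_
        congr 1; ring
      · refine Finset.sum_congr rfl fun S _ => ?_
        congr 1; ring

/-- count of multisets with prescribed sum mod `g` -/
def cntS (g x y : ℕ) (r : ZMod g) : ℕ :=
  (Finset.univ.filter (fun S : Sym (Fin y) x => ((symVal S : ℕ) : ZMod g) = r)).card

/-- the shifting step -/
theorem cntS_gcd (x y : ℕ) (hx : 0 < x) (hy : 0 < y) (m : ℤ) :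
    y * cntS y x y (m : ZMod y) = Nat.gcd x y * cntS (Nat.gcd x y) x y (m : ZMod (Nat.gcd x y)) := by
  classical
  set g := Nat.gcd x y with hg
  have hg0 : 0 < g := Nat.gcd_pos_of_pos_left _ hx
  have hgy : g ∣ y := Nat.gcd_dvd_right _ _
  have : NeZero g := ⟨hg0.ne'⟩
  have : NeZero y := ⟨hy.ne'⟩
  -- shift
  have shift : ∀ r : ZMod y, cntS y x y (r + x) = cntS y x y r := by
    intro r
    unfold cntS
    refine (Finset.card_equiv (Sym.equivCongr (Equiv.addRight (1 : Fin y))) ?_).symm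
    intro S
    have hc : Multiset.card (S : Multiset (Fin y)) = x := S.2
    have hv : ∀ a : Fin y, (((a + 1 : Fin y).val : ℕ) : ZMod y) = (a.val : ZMod y) + 1 := by
      intro a
      rw [Fin.val_add]
      simp
    have : ((symVal ((Sym.equivCongr (Equiv.addRight (1 : Fin y))) S) : ℕ) : ZMod y)
        = ((symVal S : ℕ) : ZMod y) + x := by
      simp [symVal, Sym.equivCongr, Multiset.map_map, Function.comp_def, Nat.cast_multiset_sum, hv,
        Multiset.sum_map_add, hc]
    rw [Finset.mem_filter, Finset.mem_filter, this]
    simp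
  have shiftn : ∀ (n : ℕ) (r : ZMod y), cntS y x y (r + x * n) = cntS y x y r := by
    intro n
    induction n with
    | zero => intro r; simp
    | succ n ih => intro r; rw [Nat.cast_succ, mul_add, mul_one, ← add_assoc, shift, ih]
  have shiftz : ∀ (z : ZMod y) (r : ZMod y), cntS y x y (r + x * z) = cntS y x y r := by
    intro z r
    rw [← ZMod.natCast_zmod_val z, shiftn]
  let φ := ZMod.castHom hgy (ZMod g)
  have const : ∀ t : ZMod y, φ t = (m : ZMod g) → cntS y x y t = cntS y x y (m : ZMod y) := by
    intro t ht
    obtain ⟨t, rfl⟩ := ZMod.intCast_surjective t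
    rw [map_intCast, ZMod.intCast_eq_intCast_iff, Int.modEq_comm, Int.modEq_iff_dvd] at ht
    obtain ⟨l, hl⟩ := ht
    have hb := Nat.gcd_eq_gcd_ab x y
    rw [← hg] at hb
    have : (t : ZMod y) = (m : ZMod y) + x * ((x.gcdA y * l : ℤ) : ZMod y) := by
      have : t = m + (x * x.gcdA y + y * x.gcdB y) * l := by rw [← hb, ← hl]; ring
      rw [this]; push_cast; simp; ring
    rw [this, shiftz]
  have fib : ∀ s : ZMod g, (Finset.univ.filter (fun t : ZMod y => φ t = s)).card
      = (Finset.univ.filter (fun t : ZMod y => φ t = (m : ZMod g))).card := by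
    intro s
    exact AddMonoidHom.card_fiber_eq_of_mem_range φ (ZMod.castHom_surjective hgy s)
      (ZMod.castHom_surjective hgy _)
  have fibc : y = g * (Finset.univ.filter (fun t : ZMod y => φ t = (m : ZMod g))).card := by
    have := Finset.card_eq_sum_card_fiberwise (f := φ) (s := (Finset.univ : Finset (ZMod y)))
      (t := Finset.univ) (fun _ _ => by simp)
    rw [Finset.sum_congr rfl (fun s _ => fib s)] at this
    simpa [ZMod.card] using this
  have tot : cntS g x y (m : ZMod g)
      = (Finset.univ.filter (fun t : ZMod y => φ t = (m : ZMod g))).card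
        * cntS y x y (m : ZMod y) := by
    have h1 : cntS g x y (m : ZMod g)
      = ∑ t ∈ Finset.univ.filter (fun t : ZMod y => φ t = (m : ZMod g)), cntS y x y t := by
      unfold cntS
      rw [Finset.card_eq_sum_card_fiberwise (f := fun S : Sym (Fin y) x => ((symVal S : ℕ) : ZMod y))
        (t := Finset.univ.filter (fun t : ZMod y => φ t = (m : ZMod g)))]
      · refine Finset.sum_congr rfl fun t ht => ?_
        rw [Finset.filter_filter]
        congr 1
        refine Finset.filter_congr fun S _ => ?_
        refine ⟨fun h => h.2, fun h => ⟨?_, h⟩⟩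
        have h2 := (Finset.mem_filter.1 ht).2
        rw [← h, map_natCast] at h2
        exact h2
      · intro S hS
        simpa using hS
    rw [h1, Finset.sum_congr rfl (fun t ht => const t (Finset.mem_filter.1 ht).2),
      Finset.sum_const, smul_eq_mul]
  rw [tot, ← mul_assoc, ← fibc]

section cyc
variable {n g : ℕ} [NeZero n] (h : g ∣ n)

/-- subsets of `ZMod n` with given size and sum -/
def WW (x : ℕ) (r : ZMod g) : Finset (Finset (ZMod n)) :=
  Finset.univ.filter (fun A => A.card = x ∧ ∑ a ∈ A, ZMod.castHom h (ZMod g) a = r)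

theorem WW_rot {x : ℕ} (hx : g ∣ x) (r : ZMod g) (i : ZMod n) :
    ((WW h x r).filter (fun A => i ∈ A)).card = ((WW h x r).filter (fun A => 0 ∈ A)).card := by
  classical
  have hx0 : (x : ZMod g) = 0 := (ZMod.natCast_eq_zero_iff _ _).2 hx
  refine Finset.card_equiv (Equiv.finsetCongr (Equiv.subRight i)) ?_
  intro A
  simp only [WW, Finset.mem_filter, Finset.mem_univ, true_and, Equiv.finsetCongr_apply,
    Finset.card_map, Finset.sum_map, Finset.mem_map_equiv]
  simp only [Equiv.coe_toEmbedding, Equiv.subRight_apply, map_sub, Finset.sum_sub_distrib,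
    Finset.sum_const, nsmul_eq_mul]
  have : (Equiv.subRight i).symm 0 = i := by simp
  rw [this]
  constructor
  · rintro ⟨⟨h1, h2⟩, h3⟩
    exact ⟨⟨h1, by rw [h1, hx0, h2]; simp⟩, h3⟩
  · rintro ⟨⟨h1, h2⟩, h3⟩
    rw [h1, hx0] at h2
    exact ⟨⟨h1, by simpa using h2⟩, h3⟩

theorem WW_one {x : ℕ} (hx : g ∣ x) (r : ZMod g) :
    n * ((WW h x r).filter (fun A => 0 ∈ A)).card = x * (WW h x r).card := by
  classical
  have := Finset.sum_card (B := WW h x r) (fun i => WW_rot h hx r i)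
  rw [ZMod.card] at this
  rw [← this, Finset.sum_congr rfl (fun A hA => (Finset.mem_filter.1 hA).2.1)]
  simp [mul_comm]

theorem WW_zero {x y : ℕ} (hn : x + y = n) (hx : g ∣ x) (r : ZMod g) :
    n * ((WW h x r).filter (fun A => 0 ∉ A)).card = y * (WW h x r).card := by
  classical
  have h1 := WW_one h hx r
  have h2 := Finset.card_filter_add_card_filter_not (s := WW h x r) (fun A => 0 ∈ A)
  have h3 : (x + y) * (WW h x r).card = n * (WW h x r).card := by rw [hn]
  rw [← h2, mul_add n, h1, h2, add_mul] at h3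
  omega

theorem WW_compl {x y : ℕ} (hn : x + y = n) (r : ZMod g) :
    ((WW h x r).filter (fun A => 0 ∈ A)).card
      = ((WW h y (r + ∑ a : ZMod n, ZMod.castHom h (ZMod g) a)).filter (fun A => 0 ∉ A)).card := by
  classical
  refine Finset.card_equiv ((Equiv.finsetCongr (Equiv.neg (ZMod n))).trans
    ⟨fun A => Aᶜ, fun A => Aᶜ, fun A => compl_compl A, fun A => compl_compl A⟩) ?_
  intro A
  have hc := Finset.card_add_card_compl (A.map (Equiv.neg (ZMod n)).toEmbedding)
  have hs := Finset.sum_add_sum_compl (A.map (Equiv.neg (ZMod n)).toEmbedding)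
    (fun a => ZMod.castHom h (ZMod g) a)
  rw [ZMod.card, Finset.card_map] at hc
  rw [Finset.sum_map] at hs
  simp only [Equiv.coe_toEmbedding, Equiv.neg_apply, map_neg, Finset.sum_neg_distrib] at hs
  simp only [WW, Finset.mem_filter, Finset.mem_univ, true_and, Equiv.trans_apply, Equiv.coe_fn_mk,
    Equiv.finsetCongr_apply, Finset.mem_compl, not_not, Finset.mem_map_equiv]
  have h0 : (Equiv.neg (ZMod n)).symm 0 = 0 := by simp
  rw [h0, ← hs]
  refine and_congr (and_congr ?_ ?_) Iff.rfl
  · omega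
  · constructor
    · intro e; rw [← e]; ring
    · intro e; linear_combination e

theorem WW_cnt {x y : ℕ} (hy : 0 < y) (hn : x + y = n) (r : ZMod g) :
    ((WW h x (r + ((x + x.choose 2 : ℕ) : ZMod g))).filter (fun A => 0 ∉ A)).card = cntS g x y r := by
  classical
  obtain ⟨y, rfl⟩ : ∃ k, y = k + 1 := ⟨y - 1, by omega⟩
  have sb := stars_bars x y 1
    (fun t => if (t : ZMod g) = r + ((x + x.choose 2 : ℕ) : ZMod g) then 1 else 0)
  have e1 : cntS g x (y+1) r = ∑ S : Sym (Fin (y+1)) x,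
      if ((symVal S + 1 * x + x.choose 2 : ℕ) : ZMod g) = r + ((x + x.choose 2 : ℕ) : ZMod g)
        then 1 else 0 := by
    rw [cntS, Finset.card_filter]
    refine Finset.sum_congr rfl fun S _ => ?_
    refine if_congr ?_ rfl rfl
    push_cast
    rw [one_mul, add_assoc]
    exact (add_left_inj _).symm
  let v : ZMod n ↪ ℕ := ⟨ZMod.val, ZMod.val_injective n⟩
  have e2 : Finset.Ico 1 (1 + x + y) = (Finset.univ.erase (0 : ZMod n)).map v := by
    ext i
    simp only [Finset.mem_Ico, Finset.mem_map, Finset.mem_erase, Finset.mem_univ, and_true]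
    constructor
    · rintro ⟨h1, h2⟩
      have hi : (i : ZMod n).val = i := ZMod.val_natCast_of_lt (by omega)
      refine ⟨(i : ZMod n), ?_, hi⟩
      intro h0
      rw [h0, ZMod.val_zero] at hi
      omega
    · rintro ⟨a, ha, rfl⟩
      have h1 := ZMod.val_lt a
      have h2 : a.val ≠ 0 := fun h => ha ((ZMod.val_eq_zero a).1 h)
      change 1 ≤ a.val ∧ a.val < 1 + x + y
      omega
  rw [e1, ← sb, e2, Finset.powersetCard_map, Finset.sum_map, ← Finset.card_filter]
  congr 1
  ext A
  simp only [WW, Finset.mem_filter, Finset.mem_univ, true_and, Finset.mem_powersetCard]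
  have e3 : ((∑ i ∈ (Finset.mapEmbedding v).toEmbedding A, i : ℕ) : ZMod g)
      = ∑ a ∈ A, ZMod.castHom h (ZMod g) a := by
    change ((∑ i ∈ A.map v, i : ℕ) : ZMod g) = _
    rw [Finset.sum_map, Nat.cast_sum]
    refine Finset.sum_congr rfl fun a _ => ?_
    change ((a.val : ℕ) : ZMod g) = _
    conv_rhs => rw [← ZMod.natCast_zmod_val a]
    rw [map_natCast]
  rw [e3]
  have e4 : A ⊆ Finset.univ.erase 0 ↔ 0 ∉ A := by
    rw [Finset.subset_erase]; simp
  rw [e4]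
  tauto

theorem sum_univ_cast : ∑ a : ZMod n, ZMod.castHom h (ZMod g) a = ((n.choose 2 : ℕ) : ZMod g) := by
  have : n.choose 2 = ∑ a : ZMod n, a.val := by
    obtain ⟨k, rfl⟩ : ∃ k, n = k + 1 := ⟨n - 1, by have := NeZero.pos n; omega⟩
    rw [Nat.choose_two_right, ← Finset.sum_range_id]
    exact Finset.sum_range (fun i => i)
  rw [this, Nat.cast_sum]
  refine Finset.sum_congr rfl fun a _ => ?_
  conv_lhs => rw [← ZMod.natCast_zmod_val a]
  rw [map_natCast]

end cyc

theorem cnt_sym (g x y : ℕ) (hx : 0 < x) (hy : 0 < y) (gx : g ∣ x) (gy : g ∣ y) (r : ZMod g) :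
    x * cntS g x y r = y * cntS g y x r := by
  obtain ⟨n, hn⟩ : ∃ n, x + y = n := ⟨_, rfl⟩
  have : NeZero n := ⟨by omega⟩
  have h : g ∣ n := hn ▸ dvd_add gx gy
  have a := WW_zero h hn gx (r + ((x + x.choose 2 : ℕ) : ZMod g))
  have b := WW_one h gx (r + ((x + x.choose 2 : ℕ) : ZMod g))
  rw [WW_cnt h hy hn] at a
  rw [WW_compl h hn, sum_univ_cast] at b
  have e : r + ((x + x.choose 2 : ℕ) : ZMod g) + ((n.choose 2 : ℕ) : ZMod g)
      = r + ((y + y.choose 2 : ℕ) : ZMod g) := by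
    have hx0 : (x : ZMod g) = 0 := (ZMod.natCast_eq_zero_iff _ _).2 gx
    have hy0 : (y : ZMod g) = 0 := (ZMod.natCast_eq_zero_iff _ _).2 gy
    have hnn : n.choose 2 = x.choose 2 + y.choose 2 + x * y := by
      rw [← hn, Nat.add_choose_eq]
      simp [Finset.Nat.antidiagonal_succ]
      ring
    have h2 : ((2 * x.choose 2 : ℕ) : ZMod g) = 0 := by
      rw [mul_comm, Nat.choose_two_right,
        Nat.div_mul_cancel (Nat.even_mul_pred_self x).two_dvd, Nat.cast_mul, hx0, zero_mul]
    rw [hnn]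
    push_cast at h2 ⊢
    rw [hx0, hy0]
    linear_combination h2
  rw [e, WW_cnt h hx (by omega)] at b
  have hn0 : 0 < n := by omega
  apply Nat.eq_of_mul_eq_mul_left hn0
  calc n * (x * cntS g x y r) = x * (n * cntS g x y r) := by ring
    _ = y * (n * cntS g y x r) := by rw [a, b]; ring
    _ = _ := by ring

theorem frozen_cnt (x y : ℕ) (m : ℤ) :
    (Finset.univ.filter (fun S : Sym (Fin y) x =>
        ((((S : Multiset (Fin y)).map (fun a => (a : ℕ))).sum : ℤ) ≡ m [ZMOD (y : ℤ)]))).card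
      = cntS y x y (m : ZMod y) := by
  unfold cntS
  congr 1
  refine Finset.filter_congr fun S _ => ?_
  rw [← ZMod.intCast_eq_intCast_iff]
  simp [symVal]


/-- Modular combinatorial reciprocity: for positive integers `x`, `y` and any integer
`m`, the number of multisets of `x` integers from `{0, 1, …, y-1}` whose sum is `m` mod
`y` equals the number of multisets of `y` integers from `{0, 1, …, x-1}` whose sum is
`m` mod `x`.  (Multisets of `x` elements of `Fin y` are modelled by `Sym (Fin y) x`.) -/
theorem modular_reciprocity (x y : ℕ) (hx : 0 < x) (hy : 0 < y) (m : ℤ) :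
    (Finset.univ.filter (fun S : Sym (Fin y) x =>
        ((((S : Multiset (Fin y)).map (fun a => (a : ℕ))).sum : ℤ) ≡ m [ZMOD (y : ℤ)]))).card
      = (Finset.univ.filter (fun S : Sym (Fin x) y =>
          ((((S : Multiset (Fin x)).map (fun a => (a : ℕ))).sum : ℤ) ≡ m [ZMOD (x : ℤ)]))).card := by
  rw [frozen_cnt, frozen_cnt]
  have h1 := cntS_gcd x y hx hy m
  have h2 := cntS_gcd y x hy hx m
  rw [Nat.gcd_comm y x] at h2
  have h3 := cnt_sym (Nat.gcd x y) x y hx hy (Nat.gcd_dvd_left _ _) (Nat.gcd_dvd_right _ _)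
    (m : ZMod (Nat.gcd x y))
  apply Nat.eq_of_mul_eq_mul_left (Nat.mul_pos hx hy)
  calc x * y * cntS y x y (m : ZMod y) = x * (y * cntS y x y (m : ZMod y)) := by ring
    _ = Nat.gcd x y * (x * cntS (Nat.gcd x y) x y (m : ZMod (Nat.gcd x y))) := by rw [h1]; ring
    _ = y * (x * cntS x y x (m : ZMod x)) := by rw [h3, h2]; ring
    _ = _ := by ring
end

section
/- Consider a deck of cards with a_k cards labelled k for k = 1, …, N, and let n = a_1 + ⋯ + a_N > 0. Let π be chosen uniformly at random among all arrangements of the deck (words of length n using a_k copies of the symbol k). Let P₁(π) be the number of positions i such that π_i ≤ π_j for all j < i (the size of the first pile in patience sorting with ties allowed), and let P₁′(π) be the number of positions i such that π_i < π_j for all j < i (the size of the first pile in patience sorting with ties forbidden). Then E(P₁) = Σ_{k=1}^N a_k/(a_1 + ⋯ + a_{k−1} + 1) and E(P₁′) = Σ_{k=1}^N a_k/(a_1 + ⋯ + a_{k−1} + a_k). -/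
open Finset in
theorem aux_argmin_count {n : ℕ} (S : Finset (Fin n)) (c : Fin n) (hc : c ∈ S) :
    ((univ.filter (fun τ : Equiv.Perm (Fin n) => ∀ d ∈ S, τ c ≤ τ d)).card : ℝ)
      = (Fintype.card (Equiv.Perm (Fin n)) : ℝ) / (S.card : ℝ) := by
  classical
  have hS : (S.card : ℝ) ≠ 0 := by
    have : 0 < S.card := card_pos.mpr ⟨c, hc⟩
    positivity
  have hsame : ∀ c' ∈ S, (univ.filter (fun τ : Equiv.Perm (Fin n) => ∀ d ∈ S, τ c' ≤ τ d)).card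
      = (univ.filter (fun τ : Equiv.Perm (Fin n) => ∀ d ∈ S, τ c ≤ τ d)).card := by
    intro c' hc'
    have hsw : ∀ d ∈ S, Equiv.swap c c' d ∈ S := by
      intro d hd
      rw [Equiv.swap_apply_def]
      split_ifs <;> assumption
    apply card_bij (fun τ _ => τ * Equiv.swap c c')
    · intro τ hτ
      simp only [mem_filter, mem_univ, true_and] at hτ ⊢
      intro d hd
      simpa using hτ _ (hsw d hd)
    · intro τ _ τ' _ h
      exact mul_right_cancel h
    · intro τ hτ
      simp only [mem_filter, mem_univ, true_and] at hτ
      refine ⟨τ * Equiv.swap c c', ?_, ?_⟩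
      · simp only [mem_filter, mem_univ, true_and]
        intro d hd
        simpa using hτ _ (hsw d hd)
      · simp [mul_assoc]
  have htot : ∑ c' ∈ S, (univ.filter (fun τ : Equiv.Perm (Fin n) => ∀ d ∈ S, τ c' ≤ τ d)).card
      = Fintype.card (Equiv.Perm (Fin n)) := by
    simp only [card_filter]
    rw [sum_comm]
    have : ∀ τ : Equiv.Perm (Fin n),
        ∑ c' ∈ S, (if ∀ d ∈ S, τ c' ≤ τ d then 1 else 0) = 1 := by
      intro τ
      obtain ⟨m, hm, hmin⟩ := exists_min_image S τ ⟨c, hc⟩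
      rw [sum_eq_single_of_mem m hm, if_pos hmin]
      intro b hb hbm
      rw [if_neg]
      intro h
      exact hbm (τ.injective (le_antisymm (h m hm) (hmin b hb)))
    simp [this]
  rw [sum_congr rfl hsame, sum_const, smul_eq_mul] at htot
  rw [eq_div_iff hS, ← htot]
  push_cast
  ring

open Finset in
theorem aux_main (N n : ℕ) (a : Fin N → ℕ) (hN : n = ∑ k, a k)
    (deck : Finset (Fin n → Fin N))
    (hdeck : deck = univ.filter (fun π : Fin n → Fin N =>
      ∀ k : Fin N, (univ.filter (fun i : Fin n => π i = k)).card = a k))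
    (R : Fin N → Fin N → Prop) [DecidableRel R] (g : Fin N → ℝ)
    (hg : ∀ π ∈ deck, ∀ c : Fin n,
      ((univ.filter (fun d : Fin n => d = c ∨ ¬ R (π c) (π d))).card : ℝ) = g (π c))
    (P : (Fin n → Fin N) → ℕ)
    (hP : ∀ π, P π = (univ.filter (fun i : Fin n => ∀ j : Fin n, j < i → R (π i) (π j))).card) :
    (∑ π ∈ deck, (P π : ℝ)) / (deck.card : ℝ) = ∑ k : Fin N, (a k : ℝ) / g k := by
  classical
  have hne : deck.Nonempty := by
    have e : Fin n ≃ (Σ k : Fin N, Fin (a k)) := Fintype.equivOfCardEq (by simp [hN])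
    refine ⟨fun i => (e i).1, ?_⟩
    rw [hdeck]
    simp only [mem_filter, mem_univ, true_and]
    intro k
    rw [← Fintype.card_subtype, ← Fintype.card_fin (a k)]
    apply Fintype.card_congr
    exact (e.subtypeEquiv (fun _ => Iff.rfl)).trans (Equiv.sigmaSubtype (β := fun k => Fin (a k)) k)
  have hcard : (deck.card : ℝ) ≠ 0 := by
    have := card_pos.mpr hne
    positivity
  set F : ℝ := (Fintype.card (Equiv.Perm (Fin n)) : ℝ) with hF
  have hF0 : F ≠ 0 := by
    have : 0 < Fintype.card (Equiv.Perm (Fin n)) := Fintype.card_pos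
    rw [hF]; positivity
  -- average over the permutations
  have havg : ∀ π ∈ deck, ∑ σ : Equiv.Perm (Fin n), (P (π ∘ σ) : ℝ)
      = F * ∑ k : Fin N, (a k : ℝ) / g k := by
    intro π hπ
    have h1 : ∀ σ : Equiv.Perm (Fin n), (P (π ∘ σ) : ℝ) = ∑ c : Fin n,
        if (∀ d ∈ univ.filter (fun d : Fin n => d = c ∨ ¬ R (π c) (π d)), σ⁻¹ c ≤ σ⁻¹ d)
          then (1 : ℝ) else 0 := by
      intro σ
      rw [hP, card_filter]
      push_cast
      rw [← Equiv.sum_comp σ (fun c : Fin n =>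
        if (∀ d ∈ univ.filter (fun d : Fin n => d = c ∨ ¬ R (π c) (π d)), σ⁻¹ c ≤ σ⁻¹ d)
          then (1 : ℝ) else 0)]
      refine sum_congr rfl fun i _ => ?_
      refine if_congr ?_ rfl rfl
      simp only [mem_filter, mem_univ, true_and, Function.comp]
      constructor
      · rintro h d (rfl | hd)
        · exact le_rfl
        · by_contra hlt
          push Not at hlt
          have := h (σ⁻¹ d) (by simpa using hlt)
          simp at this
          exact hd this
      · intro h j hj
        by_contra hR
        have := h (σ j) (Or.inr hR)
        simp at this
        exact absurd hj (not_lt.mpr this)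
    rw [sum_congr rfl (fun σ _ => h1 σ), sum_comm]
    have h2 : ∀ c : Fin n, (∑ σ : Equiv.Perm (Fin n),
        if (∀ d ∈ univ.filter (fun d : Fin n => d = c ∨ ¬ R (π c) (π d)), σ⁻¹ c ≤ σ⁻¹ d)
          then (1 : ℝ) else 0) = F / g (π c) := by
      intro c
      refine (Equiv.sum_comp (Equiv.inv (Equiv.Perm (Fin n))) (fun τ : Equiv.Perm (Fin n) =>
        if (∀ d ∈ univ.filter (fun d : Fin n => d = c ∨ ¬ R (π c) (π d)), τ c ≤ τ d)
          then (1 : ℝ) else 0)).trans ?_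
      rw [sum_boole, aux_argmin_count _ c (by simp), hg π hπ c]
    rw [sum_congr rfl (fun c _ => h2 c), ← sum_fiberwise univ π, mul_sum]
    refine sum_congr rfl fun k _ => ?_
    have h3 : ∀ c ∈ univ.filter (fun c : Fin n => π c = k), F / g (π c) = F / g k := by
      intro c hc
      rw [(mem_filter.mp hc).2]
    rw [hdeck] at hπ
    rw [sum_congr rfl h3, sum_const, (mem_filter.mp hπ).2 k, nsmul_eq_mul]
    ring
  have hinv : ∀ σ : Equiv.Perm (Fin n), ∑ π ∈ deck, (P (π ∘ σ) : ℝ) = ∑ π ∈ deck, (P π : ℝ) := by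
    intro σ
    have hmem : ∀ (σ : Equiv.Perm (Fin n)), ∀ π ∈ deck, π ∘ σ ∈ deck := by
      intro σ π hπ
      rw [hdeck] at hπ ⊢
      simp only [mem_filter, mem_univ, true_and] at hπ ⊢
      intro k
      rw [← hπ k, ← Fintype.card_subtype, ← Fintype.card_subtype]
      exact Fintype.card_congr (σ.subtypeEquiv (fun _ => Iff.rfl))
    refine sum_bij' (fun π _ => π ∘ σ) (fun π _ => π ∘ (σ⁻¹ : Equiv.Perm (Fin n)))
      (hmem σ) (hmem σ⁻¹) ?_ ?_ ?_
    · intro π _; funext i; simp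
    · intro π _; funext i; simp
    · intro π _; rfl
  have key : F * ∑ π ∈ deck, (P π : ℝ) = F * (deck.card * ∑ k : Fin N, (a k : ℝ) / g k) := by
    calc F * ∑ π ∈ deck, (P π : ℝ)
        = ∑ σ : Equiv.Perm (Fin n), ∑ π ∈ deck, (P (π ∘ σ) : ℝ) := by
          rw [sum_congr rfl (fun σ _ => hinv σ), sum_const, nsmul_eq_mul, card_univ]
      _ = _ := by
          rw [sum_comm, sum_congr rfl havg, sum_const, nsmul_eq_mul]
          ring
  rw [div_eq_iff hcard, mul_left_cancel₀ hF0 key]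
  ring

open Finset in
theorem aux_lt_card (N n : ℕ) (a : Fin N → ℕ) (π : Fin n → Fin N)
    (hπ : ∀ k : Fin N, (univ.filter (fun i : Fin n => π i = k)).card = a k) (k : Fin N) :
    (univ.filter (fun d : Fin n => π d < k)).card = ∑ j ∈ Iio k, a j := by
  rw [card_eq_sum_card_fiberwise (f := π) (t := Iio k)]
  · refine sum_congr rfl fun j hj => ?_
    rw [← hπ j]
    congr 1
    ext d
    simp only [mem_filter, mem_univ, true_and, mem_Iio] at hj ⊢
    constructor
    · exact fun h => h.2
    · rintro rfl
      exact ⟨hj, rfl⟩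
  · intro d hd
    simpa using hd

/-- Patience sorting from a deck with `a k` cards labelled `k` (`k ∈ Fin N`), with
`n = Σ a k > 0` cards in all.  Arrangements of the deck are words `π : Fin n → Fin N`
using each symbol `k` exactly `a k` times.  `P₁(π)`, the first pile size with ties
allowed, is the number of positions `i` with `π i ≤ π j` for all `j < i`; `P₁'(π)`,
the first pile size with ties forbidden, is the number of positions `i` with
`π i < π j` for all `j < i`.  Then, for `π` uniform over arrangements,
`E(P₁) = Σ_k a_k/(a_1 + ⋯ + a_{k-1} + 1)` and
`E(P₁') = Σ_k a_k/(a_1 + ⋯ + a_{k-1} + a_k)`. -/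
theorem expected_first_pile_size (N : ℕ) (a : Fin N → ℕ) (hn : 0 < ∑ k, a k)
    (n : ℕ) (hN : n = ∑ k, a k)
    (deck : Finset (Fin n → Fin N))
    (hdeck : deck = Finset.univ.filter (fun π : Fin n → Fin N =>
      ∀ k : Fin N, (Finset.univ.filter (fun i : Fin n => π i = k)).card = a k))
    (P1 P1' : (Fin n → Fin N) → ℕ)
    (hP1 : ∀ π, P1 π = (Finset.univ.filter
      (fun i : Fin n => ∀ j : Fin n, j < i → π i ≤ π j)).card)
    (hP1' : ∀ π, P1' π = (Finset.univ.filter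
      (fun i : Fin n => ∀ j : Fin n, j < i → π i < π j)).card) :
    ((∑ π ∈ deck, (P1 π : ℝ)) / (deck.card : ℝ)
        = ∑ k : Fin N, (a k : ℝ) / ((∑ j ∈ Finset.Iio k, (a j : ℝ)) + 1))
      ∧ ((∑ π ∈ deck, (P1' π : ℝ)) / (deck.card : ℝ)
          = ∑ k : Fin N, (a k : ℝ) / ((∑ j ∈ Finset.Iio k, (a j : ℝ)) + (a k : ℝ))) := by
  constructor
  · refine aux_main N n a hN deck hdeck (fun x y => x ≤ y) _ ?_ P1 hP1
    intro π hπ c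
    rw [hdeck] at hπ
    have hπ' := (Finset.mem_filter.mp hπ).2
    have h := aux_lt_card N n a π hπ' (π c)
    have h2 : Finset.univ.filter (fun d : Fin n => d = c ∨ ¬ π c ≤ π d)
        = insert c (Finset.univ.filter (fun d : Fin n => π d < π c)) := by
      ext d; simp
    rw [h2, Finset.card_insert_of_notMem (by simp), h]
    push_cast
    rfl
  · refine aux_main N n a hN deck hdeck (fun x y => x < y) _ ?_ P1' hP1'
    intro π hπ c
    rw [hdeck] at hπ
    have hπ' := (Finset.mem_filter.mp hπ).2
    have h := aux_lt_card N n a π hπ' (π c)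
    have h2 : Finset.univ.filter (fun d : Fin n => d = c ∨ ¬ π c < π d)
        = (Finset.univ.filter (fun d : Fin n => π d < π c)) ∪
          (Finset.univ.filter (fun d : Fin n => π d = π c)) := by
      ext d
      simp only [Finset.mem_filter, Finset.mem_univ, true_and, Finset.mem_union, not_lt]
      rw [← le_iff_lt_or_eq]
      constructor
      · rintro (rfl | h)
        · exact le_rfl
        · exact h
      · exact Or.inr
    rw [h2, Finset.card_union_of_disjoint, h, hπ']
    · push_cast
      rfl
    · rw [Finset.disjoint_filter]
      intro d _ h1 h3
      exact absurd h3 (ne_of_lt h1)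
end

section
/- Let n ≥ 1 and let I_{2n} denote the set of fixed-point-free involutions in the symmetric group S_{2n}. For π ∈ I_{2n}, let P₁(π) be the number of positions i ∈ {1, …, 2n} such that π(i) < π(j) for all j < i (the number of left-to-right minima of the one-line notation of π, equivalently the first pile size in patience sorting applied to π(1), …, π(2n)). Then Σ_{π ∈ I_{2n}} x^{P₁(π)} = Π_{i=1}^n (x² + 2(i−1)) as polynomials in x. -/
open scoped Classical

namespace FPile

noncomputable def P {N : ℕ} (π : Equiv.Perm (Fin N)) : ℕ :=
  (Finset.univ.filter (fun i : Fin N => ∀ j : Fin N, j < i → π i < π j)).card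

noncomputable def I (N : ℕ) : Finset (Equiv.Perm (Fin N)) :=
  Finset.univ.filter (fun π : Equiv.Perm (Fin N) => π * π = 1 ∧ ∀ i, π i ≠ i)

def emb {N : ℕ} (a : Fin (N+1)) : Fin N ↪ Fin (N+2) :=
  ⟨fun i => (a.succAbove i).castSucc, fun i j h => by simpa using h⟩

lemma emb_lt {N : ℕ} (a : Fin (N+1)) (i j : Fin N) : emb a i < emb a j ↔ i < j := by
  change (a.succAbove i).castSucc < (a.succAbove j).castSucc ↔ i < j
  simp [Fin.succAbove_lt_succAbove_iff]

lemma emb_lt_last {N : ℕ} (a : Fin (N+1)) (i : Fin N) : emb a i < Fin.last (N+1) :=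
  Fin.castSucc_lt_last _

lemma emb_ne {N : ℕ} (a : Fin (N+1)) (i : Fin N) : emb a i ≠ a.castSucc := by
  change (a.succAbove i).castSucc ≠ a.castSucc
  simp [Fin.succAbove_ne]

lemma cover {N : ℕ} (a : Fin (N+1)) (x : Fin (N+2)) :
    x = Fin.last (N+1) ∨ x = a.castSucc ∨ ∃ i, x = emb a i := by
  induction x using Fin.lastCases with
  | last => exact Or.inl rfl
  | cast y =>
    rcases eq_or_ne y a with rfl | h
    · exact Or.inr (Or.inl rfl)
    · obtain ⟨i, rfl⟩ := Fin.exists_succAbove_eq h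
      exact Or.inr (Or.inr ⟨i, rfl⟩)

noncomputable def ext {N : ℕ} (a : Fin (N+1)) (σ : Equiv.Perm (Fin N)) :
    Equiv.Perm (Fin (N+2)) :=
  σ.viaEmbedding (emb a) * Equiv.swap a.castSucc (Fin.last (N+1))

lemma ext_emb {N : ℕ} (a : Fin (N+1)) (σ : Equiv.Perm (Fin N)) (i : Fin N) :
    ext a σ (emb a i) = emb a (σ i) := by
  rw [ext, Equiv.Perm.mul_apply,
    Equiv.swap_apply_of_ne_of_ne (emb_ne a i) (emb_lt_last a i).ne,
    Equiv.Perm.viaEmbedding_apply]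

lemma ext_cast {N : ℕ} (a : Fin (N+1)) (σ : Equiv.Perm (Fin N)) :
    ext a σ a.castSucc = Fin.last (N+1) := by
  rw [ext, Equiv.Perm.mul_apply, Equiv.swap_apply_left,
    Equiv.Perm.viaEmbedding_apply_of_notMem]
  rintro ⟨i, hi⟩
  exact (emb_lt_last a i).ne hi

lemma ext_last {N : ℕ} (a : Fin (N+1)) (σ : Equiv.Perm (Fin N)) :
    ext a σ (Fin.last (N+1)) = a.castSucc := by
  rw [ext, Equiv.Perm.mul_apply, Equiv.swap_apply_right,
    Equiv.Perm.viaEmbedding_apply_of_notMem]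
  rintro ⟨i, hi⟩
  exact emb_ne a i hi

lemma mem_I {N : ℕ} (π : Equiv.Perm (Fin N)) :
    π ∈ I N ↔ (∀ i, π (π i) = i) ∧ ∀ i, π i ≠ i := by
  simp [I, Equiv.ext_iff]

lemma ext_mem {N : ℕ} (a : Fin (N+1)) (σ : Equiv.Perm (Fin N)) (h : σ ∈ I N) :
    ext a σ ∈ I (N+2) := by
  rw [mem_I] at *
  constructor
  · intro x
    rcases cover a x with rfl | rfl | ⟨i, rfl⟩
    · rw [ext_last, ext_cast]
    · rw [ext_cast, ext_last]
    · rw [ext_emb, ext_emb, h.1]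
  · intro x
    rcases cover a x with rfl | rfl | ⟨i, rfl⟩
    · rw [ext_last]; exact (Fin.castSucc_lt_last a).ne
    · rw [ext_cast]; exact (Fin.castSucc_lt_last a).ne'
    · rw [ext_emb]; exact fun e => h.2 i ((emb a).injective e)

lemma ext_inj {N : ℕ} (a b : Fin (N+1)) (σ τ : Equiv.Perm (Fin N)) (h : ext a σ = ext b τ) :
    a = b ∧ σ = τ := by
  have h1 := ext_last a σ
  rw [h, ext_last] at h1
  have h2 : b = a := by simpa using h1
  subst h2
  refine ⟨rfl, Equiv.ext fun i => (emb b).injective ?_⟩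
  rw [← ext_emb, ← ext_emb, h]

lemma ext_surj {N : ℕ} (π : Equiv.Perm (Fin (N+2))) (h : π ∈ I (N+2)) :
    ∃ a, ∃ σ ∈ I N, ext a σ = π := by
  rw [mem_I] at h
  obtain ⟨a, ha⟩ : ∃ a : Fin (N+1), a.castSucc = π (Fin.last (N+1)) :=
    Fin.exists_castSucc_eq.2 (h.2 _)
  have ha' : π a.castSucc = Fin.last (N+1) := by rw [ha, h.1]
  have key : ∀ i, ∃ j, π (emb a i) = emb a j := by
    intro i
    rcases cover a (π (emb a i)) with e | e | e
    · rw [← ha'] at e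
      exact absurd (π.injective e) (emb_ne a i)
    · rw [ha] at e
      exact absurd (π.injective e) (emb_lt_last a i).ne
    · exact e
  choose f hf using key
  have hinv : Function.Involutive f := by
    intro i
    apply (emb a).injective
    rw [← hf, ← hf, h.1]
  refine ⟨a, hinv.toPerm, ?_, ?_⟩
  · rw [mem_I]
    refine ⟨hinv, fun i e => h.2 (emb a i) ?_⟩
    rw [hf]
    exact congrArg _ e
  · ext1 x
    rcases cover a x with rfl | rfl | ⟨i, rfl⟩
    · rw [ext_last, ha]
    · rw [ext_cast, ha']
    · rw [ext_emb, hf]; rfl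

lemma min_emb {N : ℕ} (a : Fin (N+1)) (σ : Equiv.Perm (Fin N)) (i : Fin N) :
    (∀ j, j < emb a i → ext a σ (emb a i) < ext a σ j) ↔ ∀ j, j < i → σ i < σ j := by
  constructor
  · intro h j hj
    have := h (emb a j) ((emb_lt a j i).2 hj)
    rwa [ext_emb, ext_emb, emb_lt] at this
  · intro h x hx
    rw [ext_emb]
    rcases cover a x with rfl | rfl | ⟨j, rfl⟩
    · exact absurd hx (emb_lt_last a i).not_gt
    · rw [ext_cast]; exact emb_lt_last _ _
    · rw [ext_emb, emb_lt]; exact h j ((emb_lt a j i).1 hx)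

lemma min_cast {N : ℕ} (a : Fin (N+1)) (σ : Equiv.Perm (Fin N)) :
    (∀ j, j < a.castSucc → ext a σ a.castSucc < ext a σ j) ↔ a = 0 := by
  constructor
  · intro h
    by_contra h0
    have := h 0 (by rw [← Fin.castSucc_zero, Fin.castSucc_lt_castSucc_iff]
                    exact Fin.pos_of_ne_zero h0)
    rw [ext_cast] at this
    exact absurd this (Fin.le_last _).not_gt
  · rintro rfl j hj
    exact absurd hj (by simp)

lemma min_last {N : ℕ} (a : Fin (N+1)) (σ : Equiv.Perm (Fin N)) :
    (∀ j, j < Fin.last (N+1) → ext a σ (Fin.last (N+1)) < ext a σ j) ↔ a = 0 := by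
  constructor
  · intro h
    by_contra h0
    have h1 := h ((ext a σ).symm 0) (by
      refine lt_of_le_of_ne (Fin.le_last _) fun e => h0 ?_
      rw [Equiv.symm_apply_eq, ext_last, ← Fin.castSucc_zero, Fin.castSucc_inj] at e
      exact e.symm)
    rw [Equiv.apply_symm_apply] at h1
    exact absurd h1 (Fin.zero_le _).not_gt
  · rintro rfl j hj
    rw [ext_last, Fin.castSucc_zero]
    refine Fin.pos_of_ne_zero fun e => hj.ne ((ext 0 σ).injective ?_)
    rw [e, ext_last, Fin.castSucc_zero]

lemma P_ext {N : ℕ} (a : Fin (N+1)) (σ : Equiv.Perm (Fin N)) :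
    P (ext a σ) = P σ + if a = 0 then 2 else 0 := by
  have e : ∀ i, (a.succAbove i).castSucc = emb a i := fun _ => rfl
  unfold P
  rw [Finset.card_filter, Finset.card_filter, Fin.sum_univ_castSucc, Fin.sum_univ_succAbove _ a]
  simp only [e, min_emb, min_cast, min_last]
  split_ifs <;> omega

lemma rec_sum (N : ℕ) :
    ∑ π ∈ I (N+2), (Polynomial.X : Polynomial ℤ) ^ P π =
      (∑ π ∈ I N, (Polynomial.X : Polynomial ℤ) ^ P π) *
        (Polynomial.X ^ 2 + Polynomial.C (N : ℤ)) := by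
  have h : ∑ π ∈ I (N+2), (Polynomial.X : Polynomial ℤ) ^ P π =
      ∑ p ∈ (Finset.univ : Finset (Fin (N+1))) ×ˢ I N,
        (Polynomial.X : Polynomial ℤ) ^ P (ext p.1 p.2) := by
    symm
    refine Finset.sum_bij (fun p _ => ext p.1 p.2) ?_ ?_ ?_ ?_
    · rintro ⟨a, σ⟩ hp
      exact ext_mem a σ (Finset.mem_product.1 hp).2
    · rintro ⟨a, σ⟩ _ ⟨b, τ⟩ _ hh
      obtain ⟨rfl, rfl⟩ := ext_inj _ _ _ _ hh
      rfl
    · intro π hπ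
      obtain ⟨a, σ, hσ, rfl⟩ := ext_surj π hπ
      exact ⟨(a, σ), by simp [hσ], rfl⟩
    · intros; rfl
  rw [h, Finset.sum_product_right, Finset.sum_mul]
  refine Finset.sum_congr rfl fun σ _ => ?_
  simp only [P_ext, pow_add]
  rw [← Finset.mul_sum, Fin.sum_univ_succ]
  simp

end FPile


/-- For `I_{2n}` the set of fixed-point-free involutions of `S_{2n}`, and `P₁(π)` the
number of left-to-right minima of the one-line notation of `π` (the first pile size in
patience sorting applied to `π(1), …, π(2n)`),
`Σ_{π ∈ I_{2n}} x^{P₁(π)} = Π_{i=1}^n (x² + 2(i-1))` as polynomials in `x`. -/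
theorem involution_first_pile_genfunc (n : ℕ) (hn : 1 ≤ n) :
    ∑ π ∈ Finset.univ.filter (fun π : Equiv.Perm (Fin (2 * n)) =>
        π * π = 1 ∧ ∀ i, π i ≠ i),
      (Polynomial.X : Polynomial ℤ) ^
        ((Finset.univ.filter (fun i : Fin (2 * n) =>
          ∀ j : Fin (2 * n), j < i → π i < π j)).card)
      = ∏ i ∈ Finset.range n,
          ((Polynomial.X : Polynomial ℤ) ^ 2 + Polynomial.C (2 * (i : ℤ))) := by
  clear hn
  change ∑ π ∈ FPile.I (2 * n), (Polynomial.X : Polynomial ℤ) ^ FPile.P π = _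
  induction n with
  | zero =>
    have : FPile.I (2 * 0) = {1} := by
      ext π
      rw [FPile.mem_I, Finset.mem_singleton]
      exact ⟨fun _ => Equiv.ext fun i => Fin.elim0 i,
        fun _ => ⟨fun i => Fin.elim0 i, fun i => Fin.elim0 i⟩⟩
    rw [this]
    simp [FPile.P]
  | succ n ih =>
    rw [Finset.prod_range_succ, ← ih]
    have := FPile.rec_sum (2 * n)
    push_cast at this
    exact this
end
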